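/- Let d ≥ 3 and N ≥ 1 be integers, let k ∈ {1,…,d−1}, and let ℓ_k, ℓ_{k+1}, …, ℓ_{d+1} be nonnegative integers with ℓ_k < N, ℓ_j ≤ N for all j ∈ {k,…,d+1}, and ℓ_i + ℓ_j ≥ N for all k ≤ i < j ≤ d+1. Then |H^d(N,…,N,ℓ_k+1,ℓ_{k+1},…,ℓ_{d+1},N)| − |H^d(N,…,N,ℓ_k,ℓ_{k+1},…,ℓ_{d+1},N)| = C(N−ℓ_k+d−2, d−1), where in both sets the first k−1 parameters equal N, and C(a,b) denotes the binomial coefficient. -/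

import Mathlib

open Finset

/-- `|ν^{j+1}| = ν_{j+1} + ⋯ + ν_d` (1-indexed). -/
def tailSum (d : ℕ) (ν : Fin d → ℕ) (j : Fin d) : ℕ :=
  ∑ i ∈ Finset.univ.filter (fun i : Fin d => (j : ℕ) < (i : ℕ)), ν i

/-- `|ℓ^{j+1}| = ℓ_{j+1} + ⋯ + ℓ_{d+1}` (1-indexed). -/
def tailSumL (d : ℕ) (ℓ : Fin (d + 1) → ℕ) (j : Fin d) : ℕ :=
  ∑ i ∈ Finset.univ.filter (fun i : Fin (d + 1) => (j : ℕ) < (i : ℕ)), ℓ i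

/-- The set `H^d(ℓ₁,…,ℓ_{d+1},N)`. -/
def Hd (d N : ℕ) (ℓ : Fin (d + 1) → ℕ) : Finset (Fin d → ℕ) :=
  (Fintype.piFinset fun _ : Fin d => Finset.range (N + 1)).filter fun ν =>
    (∀ j : Fin d, ν j ≤ ℓ j.castSucc) ∧
    (∀ j : Fin d, ν j + 2 * tailSum d ν j ≤ tailSumL d ℓ j) ∧
    (∑ i, ν i) + N ≤ ∑ i, ℓ i ∧ (∑ i, ν i) ≤ N


lemma mem_Hd_iff (d N : ℕ) (ℓ : Fin (d + 1) → ℕ) (ν : Fin d → ℕ) :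
    ν ∈ Hd d N ℓ ↔ (∀ j : Fin d, ν j ≤ ℓ j.castSucc) ∧
    (∀ j : Fin d, ν j + 2 * tailSum d ν j ≤ tailSumL d ℓ j) ∧
    (∑ i, ν i) + N ≤ ∑ i, ℓ i ∧ (∑ i, ν i) ≤ N := by
  unfold Hd
  rw [Finset.mem_filter]
  constructor
  · exact fun h => h.2
  · intro h
    refine ⟨?_, h⟩
    rw [Fintype.mem_piFinset]
    intro j
    have := Finset.single_le_sum (f := ν) (fun i _ => Nat.zero_le _) (Finset.mem_univ j)
    have := h.2.2.2
    rw [Finset.mem_range]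
    omega

/-- The simplex slice. -/
def Slice (d N a : ℕ) (κ : Fin d) : Finset (Fin d → ℕ) :=
  (Fintype.piFinset fun _ : Fin d => Finset.range (N + 1)).filter fun ν =>
    ν κ = a + 1 ∧ (∑ i, ν i) ≤ N

lemma mem_Slice_iff (d N a : ℕ) (κ : Fin d) (ν : Fin d → ℕ) :
    ν ∈ Slice d N a κ ↔ ν κ = a + 1 ∧ (∑ i, ν i) ≤ N := by
  unfold Slice
  rw [Finset.mem_filter]
  constructor
  · exact fun h => h.2
  · intro h
    refine ⟨?_, h⟩
    rw [Fintype.mem_piFinset]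
    intro j
    have := Finset.single_le_sum (f := ν) (fun i _ => Nat.zero_le _) (Finset.mem_univ j)
    have := h.2
    rw [Finset.mem_range]
    omega

lemma sum_update_add {n : ℕ} (ν : Fin n → ℕ) (κ : Fin n) (v : ℕ) :
    (∑ i, Function.update ν κ v i) + ν κ = (∑ i, ν i) + v := by
  rw [Finset.sum_update_of_mem (Finset.mem_univ κ),
    ← Finset.add_sum_erase Finset.univ ν (Finset.mem_univ κ), Finset.sdiff_singleton_eq_erase]
  ring

lemma card_Slice (d N a : ℕ) (κ : Fin d) (ha : a < N) :
    (Slice d N a κ).card = (N - a + d - 2).choose (d - 1) := by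
  have hd : 0 < d := lt_of_le_of_lt (Nat.zero_le _) κ.2
  have h : (Slice d N a κ).card =
      (Finset.piAntidiag (Finset.univ : Finset (Fin d)) (N - a - 1)).card := by
    refine Finset.card_nbij' (fun ν => Function.update ν κ (N - ∑ i, ν i))
      (fun μ => Function.update μ κ (a + 1)) ?_ ?_ ?_ ?_
    · intro ν hν
      have hν := (mem_Slice_iff _ _ _ _ _).1 hν
      have := sum_update_add ν κ (N - ∑ i, ν i)
      simp only [Finset.mem_coe, Finset.mem_piAntidiag]
      refine ⟨?_, by simp⟩
      change ∑ i, Function.update ν κ (N - ∑ i, ν i) i = _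
      omega
    · intro μ hμ
      simp only [Finset.mem_coe, Finset.mem_piAntidiag] at hμ
      have hμ1 : ∑ i, μ i = N - a - 1 := hμ.1
      have := sum_update_add μ κ (a + 1)
      refine (mem_Slice_iff _ _ _ _ _).2 ⟨by simp, ?_⟩
      change ∑ i, Function.update μ κ (a + 1) i ≤ N
      omega
    · intro ν hν
      have hν := (mem_Slice_iff _ _ _ _ _).1 hν
      simp only [Function.update_idem]
      rw [← hν.1, Function.update_eq_self]
    · intro μ hμ
      simp only [Finset.mem_coe, Finset.mem_piAntidiag] at hμ
      have hμ1 : ∑ i, μ i = N - a - 1 := hμ.1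
      have := sum_update_add μ κ (a + 1)
      simp only [Function.update_idem]
      have h2 : N - ∑ i, Function.update μ κ (a + 1) i = μ κ := by omega
      rw [h2, Function.update_eq_self]
  have h2 : (Finset.piAntidiag (Finset.univ : Finset (Fin d)) (N - a - 1)).card =
      (Finset.finsuppAntidiag (Finset.univ : Finset (Fin d)) (N - a - 1)).card := by
    simp [Finset.finsuppAntidiag]
  rw [h, h2, Finset.card_finsuppAntidiag_nat_eq_choose, Finset.card_univ, Fintype.card_fin]
  rw [← Nat.choose_symm_of_eq_add (n := N - a + d - 2) (a := N - a - 1) (b := d - 1) (by omega)]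
  congr 1
  omega

lemma tail_le {d : ℕ} (ν : Fin d → ℕ) (j : Fin d) : ν j + tailSum d ν j ≤ ∑ i, ν i := by
  unfold tailSum
  rw [← Finset.sum_insert (by simp)]
  exact Finset.sum_le_sum_of_subset (Finset.subset_univ _)

lemma tail_le' {d : ℕ} (ν : Fin d → ℕ) (κ j : Fin d) (h : κ < j) :
    ν κ + (ν j + tailSum d ν j) ≤ ∑ i, ν i := by
  unfold tailSum
  rw [← Finset.sum_insert (by simp), ← Finset.sum_insert]
  · exact Finset.sum_le_sum_of_subset (Finset.subset_univ _)
  · simp only [Finset.mem_insert, Finset.mem_filter, Finset.mem_univ, true_and, Fin.ext_iff]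
    have : (κ : ℕ) < j := h
    omega

lemma tailSumL_update {d : ℕ} (ℓ : Fin (d + 1) → ℕ) (κ : Fin (d + 1)) (j : Fin d) :
    tailSumL d (Function.update ℓ κ (ℓ κ + 1)) j =
      tailSumL d ℓ j + if (j : ℕ) < κ then 1 else 0 := by
  unfold tailSumL
  have : ∀ i, Function.update ℓ κ (ℓ κ + 1) i = ℓ i + if i = κ then 1 else 0 := by
    intro i
    by_cases h : i = κ
    · subst h; simp
    · simp [h]
  simp only [this, Finset.sum_add_distrib]
  simp [Finset.sum_ite_eq']

lemma le_tailSumL {d : ℕ} (ℓ : Fin (d + 1) → ℕ) (j : Fin d) (s : Finset (Fin (d + 1)))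
    (hs : ∀ i ∈ s, (j : ℕ) < i) : ∑ i ∈ s, ℓ i ≤ tailSumL d ℓ j := by
  unfold tailSumL
  apply Finset.sum_le_sum_of_subset
  intro i hi
  simpa using hs i hi

lemma pair_tail {d : ℕ} (ℓ : Fin (d + 1) → ℕ) (j : Fin d) (a b : Fin (d + 1))
    (h1 : (j : ℕ) < a) (h2 : a < b) : ℓ a + ℓ b ≤ tailSumL d ℓ j := by
  rw [← Finset.sum_pair h2.ne]
  apply le_tailSumL
  have : (a : ℕ) < b := h2
  intro i hi
  simp only [Finset.mem_insert, Finset.mem_singleton] at hi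
  rcases hi with rfl | rfl <;> omega

lemma triple_sum {n : ℕ} (ℓ : Fin n → ℕ) (a b c : Fin n) (h1 : a < b) (h2 : b < c) :
    ∑ i ∈ {a, b, c}, ℓ i = ℓ a + ℓ b + ℓ c := by
  rw [Finset.sum_insert, Finset.sum_pair h2.ne, add_assoc]
  simp only [Finset.mem_insert, Finset.mem_singleton, not_or]
  exact ⟨h1.ne, (h1.trans h2).ne⟩

lemma triple_tail {d : ℕ} (ℓ : Fin (d + 1) → ℕ) (j : Fin d) (a b c : Fin (d + 1))
    (h1 : (j : ℕ) < a) (h2 : a < b) (h3 : b < c) : ℓ a + ℓ b + ℓ c ≤ tailSumL d ℓ j := by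
  rw [← triple_sum ℓ a b c h2 h3]
  apply le_tailSumL
  have : (a : ℕ) < b := h2
  have : (b : ℕ) < c := h3
  intro i hi
  simp only [Finset.mem_insert, Finset.mem_singleton] at hi
  rcases hi with rfl | rfl | rfl <;> omega

lemma quad_sum {n : ℕ} (ℓ : Fin n → ℕ) (a b c e : Fin n) (h1 : a < b) (h2 : b < c)
    (h3 : c < e) : ∑ i ∈ {a, b, c, e}, ℓ i = ℓ a + ℓ b + ℓ c + ℓ e := by
  rw [Finset.sum_insert, triple_sum ℓ b c e h2 h3, add_assoc, add_assoc, add_assoc]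
  simp only [Finset.mem_insert, Finset.mem_singleton, not_or]
  exact ⟨h1.ne, (h1.trans h2).ne, (h1.trans (h2.trans h3)).ne⟩

lemma quad_tail {d : ℕ} (ℓ : Fin (d + 1) → ℕ) (j : Fin d) (a b c e : Fin (d + 1))
    (h1 : (j : ℕ) < a) (h2 : a < b) (h3 : b < c) (h4 : c < e) :
    ℓ a + ℓ b + ℓ c + ℓ e ≤ tailSumL d ℓ j := by
  rw [← quad_sum ℓ a b c e h2 h3 h4]
  apply le_tailSumL
  have : (a : ℕ) < b := h2
  have : (b : ℕ) < c := h3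
  have : (c : ℕ) < e := h4
  intro i hi
  simp only [Finset.mem_insert, Finset.mem_singleton] at hi
  rcases hi with rfl | rfl | rfl | rfl <;> omega

lemma quad_all {n : ℕ} (ℓ : Fin n → ℕ) (a b c e : Fin n) (h1 : a < b) (h2 : b < c)
    (h3 : c < e) : ℓ a + ℓ b + ℓ c + ℓ e ≤ ∑ i, ℓ i := by
  rw [← quad_sum ℓ a b c e h1 h2 h3]
  exact Finset.sum_le_sum_of_subset (Finset.subset_univ _)

lemma Hd_mono {d N : ℕ} (ℓ : Fin (d + 1) → ℕ) (κ : Fin (d + 1)) :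
    Hd d N ℓ ⊆ Hd d N (Function.update ℓ κ (ℓ κ + 1)) := by
  intro ν hν
  rw [mem_Hd_iff] at hν ⊢
  obtain ⟨h1, h2, h3, h4⟩ := hν
  have := sum_update_add ℓ κ (ℓ κ + 1)
  refine ⟨fun j => ?_, fun j => ?_, by omega, h4⟩
  · have := h1 j
    by_cases h : j.castSucc = κ
    · rw [h] at this ⊢; simp; omega
    · rw [Function.update_of_ne h]; exact this
  · rw [tailSumL_update]
    have := h2 j
    omega

/-- Case `k ≤ d - 2`, with `κ = k - 1`. -/
lemma case_one (d N κ : ℕ) (hκ : κ + 3 ≤ d) (ℓ : Fin (d + 1) → ℕ)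
    (hfirst : ∀ t : Fin (d + 1), (t : ℕ) < κ → ℓ t = N)
    (hklt : ℓ ⟨κ, by omega⟩ < N)
    (hpair : ∀ s t : Fin (d + 1), κ ≤ (s : ℕ) → s < t → N ≤ ℓ s + ℓ t) :
    Hd d N (Function.update ℓ ⟨κ, by omega⟩ (ℓ ⟨κ, by omega⟩ + 1)) \ Hd d N ℓ =
      Slice d N (ℓ ⟨κ, by omega⟩) ⟨κ, by omega⟩ := by
  have hκd : κ < d := by omega
  have e0 : κ < d + 1 := by omega
  have e1 : κ + 1 < d + 1 := by omega
  have e2 : κ + 2 < d + 1 := by omega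
  have e3 : κ + 3 < d + 1 := by omega
  have l01 : (⟨κ, e0⟩ : Fin (d + 1)) < ⟨κ + 1, e1⟩ := by simp [Fin.lt_def]
  have l12 : (⟨κ + 1, e1⟩ : Fin (d + 1)) < ⟨κ + 2, e2⟩ := by simp [Fin.lt_def]
  have l23 : (⟨κ + 2, e2⟩ : Fin (d + 1)) < ⟨κ + 3, e3⟩ := by simp [Fin.lt_def]
  have p01 := hpair _ _ (by simp) l01
  have p23 := hpair _ _ (by simp) l23
  have hall := quad_all ℓ _ _ _ _ l01 l12 l23
  have hupd := sum_update_add ℓ ⟨κ, e0⟩ (ℓ ⟨κ, e0⟩ + 1)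
  have hbefore : ∀ j : Fin d, (j : ℕ) < κ → 2 * N ≤ tailSumL d ℓ j := by
    intro j hj
    have := quad_tail ℓ j _ _ _ _ (by simpa using hj) l01 l12 l23
    omega
  ext ν
  rw [Finset.mem_sdiff, mem_Slice_iff, mem_Hd_iff, mem_Hd_iff]
  constructor
  · rintro ⟨⟨h1, h2, h3, h4⟩, h5⟩
    refine ⟨?_, h4⟩
    by_contra hne
    apply h5
    refine ⟨fun j => ?_, fun j => ?_, by omega, h4⟩
    · have := h1 j
      by_cases h : (j : ℕ) = κ
      · have hj : j = ⟨κ, hκd⟩ := Fin.ext h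
        subst hj
        simp only [Fin.castSucc_mk, Function.update_self] at this ⊢
        omega
      · rwa [Function.update_of_ne] at this
        simpa [Fin.ext_iff] using h
    · have := h2 j
      rw [tailSumL_update] at this
      by_cases h : (j : ℕ) < κ
      · have := hbefore j h
        have := tail_le ν j
        omega
      · simpa [h] using this
  · rintro ⟨h1, h4⟩
    refine ⟨⟨fun j => ?_, fun j => ?_, by omega, h4⟩, ?_⟩
    · by_cases h : (j : ℕ) = κ
      · have hj : j = ⟨κ, hκd⟩ := Fin.ext h
        subst hj
        simp only [Fin.castSucc_mk, Function.update_self]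
        omega
      · rw [Function.update_of_ne (by simpa [Fin.ext_iff] using h)]
        have t1 := tail_le ν j
        rcases Nat.lt_or_gt_of_ne h with h | h
        · rw [hfirst _ (by simpa using h)]
          omega
        · have t2 := tail_le' ν ⟨κ, by omega⟩ j h
          have := hpair ⟨κ, e0⟩ j.castSucc (by simp) (by simpa [Fin.lt_def] using h)
          omega
    · rw [tailSumL_update]
      have t1 := tail_le ν j
      rcases lt_trichotomy (j : ℕ) κ with h | h | h
      · have := hbefore j h
        omega
      · have hj : j = ⟨κ, hκd⟩ := Fin.ext h
        subst hj
        have := triple_tail ℓ ⟨κ, by omega⟩ _ _ _ (by simp) l12 l23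
        omega
      · have t2 := tail_le' ν ⟨κ, by omega⟩ j h
        by_cases hl : (j : ℕ) + 1 = d
        · have : tailSum d ν j = 0 := by
            unfold tailSum
            apply Finset.sum_eq_zero
            intro i hi
            simp at hi
            have := i.2
            omega
          have hs := le_tailSumL ℓ j {j.succ} (by simp)
          rw [Finset.sum_singleton] at hs
          have := hpair ⟨κ, e0⟩ j.succ (by simp) (by simp [Fin.lt_def]; omega)
          omega
        · have hj := j.2
          have hs := pair_tail ℓ j ⟨j + 1, by omega⟩ ⟨j + 2, by omega⟩ (by simp)
            (by simp [Fin.lt_def])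
          have := hpair ⟨κ, e0⟩ ⟨j + 1, by omega⟩ (by simp) (by simp [Fin.lt_def]; omega)
          have := hpair ⟨κ, e0⟩ ⟨j + 2, by omega⟩ (by simp) (by simp [Fin.lt_def]; omega)
          omega
    · rintro ⟨h, -⟩
      have := h ⟨κ, by omega⟩
      simp only [Fin.castSucc_mk] at this
      omega

/-- sum of the first `e` coordinates -/
def headSum (e : ℕ) (ν : Fin (e + 3) → ℕ) : ℕ :=
  ∑ i ∈ Finset.univ.filter (fun i : Fin (e + 3) => (i : ℕ) < e), ν i

lemma headSum_update (e : ℕ) (ν : Fin (e + 3) → ℕ) (i : Fin (e + 3)) (hi : e ≤ (i : ℕ)) (v : ℕ) :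
    headSum e (Function.update ν i v) = headSum e ν := by
  unfold headSum
  apply Finset.sum_congr rfl
  intro j hj
  simp only [Finset.mem_filter, Finset.mem_univ, true_and] at hj
  rw [Function.update_of_ne]
  rintro rfl
  omega

lemma sum_eq_head (e : ℕ) (ν : Fin (e + 3) → ℕ) :
    ∑ i, ν i = headSum e ν + (ν ⟨e, by omega⟩ + ν ⟨e + 1, by omega⟩ + ν ⟨e + 2, by omega⟩) := by
  unfold headSum
  rw [← triple_sum ν _ _ _ (by simp [Fin.lt_def]) (by simp [Fin.lt_def]),
    ← Finset.sum_filter_add_sum_filter_not Finset.univ (fun i : Fin (e + 3) => (i : ℕ) < e)]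
  congr 1
  apply Finset.sum_congr _ (fun _ _ => rfl)
  ext i
  have := i.2
  simp only [Finset.mem_filter, Finset.mem_univ, true_and, Finset.mem_insert,
    Finset.mem_singleton, Fin.ext_iff]
  omega

lemma mem_two (e N : ℕ) (ℓ : Fin (e + 3 + 1) → ℕ)
    (hfirst : ∀ t : Fin (e + 3 + 1), (t : ℕ) ≤ e → ℓ t = N) (a b c : ℕ)
    (ha : ℓ ⟨e + 1, by omega⟩ = a) (hb : ℓ ⟨e + 2, by omega⟩ = b) (hc : ℓ ⟨e + 3, by omega⟩ = c)
    (hab : N ≤ a + b) (ν : Fin (e + 3) → ℕ) (x y z : ℕ) (hz : ν ⟨e, by omega⟩ = z)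
    (hx : ν ⟨e + 1, by omega⟩ = x) (hy : ν ⟨e + 2, by omega⟩ = y) :
    ν ∈ Hd (e + 3) N ℓ ↔ x ≤ a ∧ y ≤ b ∧ y ≤ c ∧ x + 2 * y ≤ b + c ∧
      z + 2 * (x + y) ≤ a + b + c ∧ headSum e ν + (z + x + y) ≤ N := by
  have f0 : e < e + 3 := by omega
  have f1 : e + 1 < e + 3 := by omega
  have f2 : e + 2 < e + 3 := by omega
  have e0 : e < e + 3 + 1 := by omega
  have e1 : e + 1 < e + 3 + 1 := by omega
  have e2 : e + 2 < e + 3 + 1 := by omega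
  have e3 : e + 3 < e + 3 + 1 := by omega
  have l01 : (⟨e, e0⟩ : Fin (e + 3 + 1)) < ⟨e + 1, e1⟩ := by simp [Fin.lt_def]
  have l12 : (⟨e + 1, e1⟩ : Fin (e + 3 + 1)) < ⟨e + 2, e2⟩ := by simp [Fin.lt_def]
  have l23 : (⟨e + 2, e2⟩ : Fin (e + 3 + 1)) < ⟨e + 3, e3⟩ := by simp [Fin.lt_def]
  have hNe : ℓ ⟨e, e0⟩ = N := hfirst _ (by simp)
  have hall := quad_all ℓ _ _ _ _ l01 l12 l23
  have hsum := sum_eq_head e ν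
  have s2 : tailSum (e + 3) ν ⟨e + 2, by omega⟩ = 0 := by
    unfold tailSum
    apply Finset.sum_eq_zero
    intro i hi
    simp at hi
    have := i.2
    omega
  have s1 : tailSum (e + 3) ν ⟨e + 1, by omega⟩ = y := by
    unfold tailSum
    rw [← hy, ← Finset.sum_singleton ν]
    apply Finset.sum_congr _ (fun _ _ => rfl)
    ext i
    have := i.2
    simp only [Finset.mem_filter, Finset.mem_univ, true_and, Finset.mem_singleton, Fin.ext_iff]
    omega
  have s0 : tailSum (e + 3) ν ⟨e, by omega⟩ = x + y := by
    unfold tailSum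
    rw [← hx, ← hy, ← Finset.sum_pair (by simp [Fin.ext_iff])]
    apply Finset.sum_congr _ (fun _ _ => rfl)
    ext i
    have := i.2
    simp only [Finset.mem_filter, Finset.mem_univ, true_and, Finset.mem_insert,
      Finset.mem_singleton, Fin.ext_iff]
    omega
  have u2 : tailSumL (e + 3) ℓ ⟨e + 2, by omega⟩ = c := by
    unfold tailSumL
    rw [← hc, ← Finset.sum_singleton ℓ]
    apply Finset.sum_congr _ (fun _ _ => rfl)
    ext i
    have := i.2
    simp only [Finset.mem_filter, Finset.mem_univ, true_and, Finset.mem_singleton, Fin.ext_iff]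
    omega
  have u1 : tailSumL (e + 3) ℓ ⟨e + 1, by omega⟩ = b + c := by
    unfold tailSumL
    rw [← hb, ← hc, ← Finset.sum_pair l23.ne]
    apply Finset.sum_congr _ (fun _ _ => rfl)
    ext i
    have := i.2
    simp only [Finset.mem_filter, Finset.mem_univ, true_and, Finset.mem_insert,
      Finset.mem_singleton, Fin.ext_iff]
    omega
  have u0 : tailSumL (e + 3) ℓ ⟨e, by omega⟩ = a + b + c := by
    unfold tailSumL
    rw [← ha, ← hb, ← hc, ← triple_sum ℓ _ _ _ l12 l23]
    apply Finset.sum_congr _ (fun _ _ => rfl)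
    ext i
    have := i.2
    simp only [Finset.mem_filter, Finset.mem_univ, true_and, Finset.mem_insert,
      Finset.mem_singleton, Fin.ext_iff]
    omega
  rw [mem_Hd_iff]
  constructor
  · rintro ⟨h1, h2, h3, h4⟩
    have a1 := h1 ⟨e + 1, by omega⟩
    have a2 := h1 ⟨e + 2, by omega⟩
    have b0 := h2 ⟨e, by omega⟩
    have b1 := h2 ⟨e + 1, by omega⟩
    have b2 := h2 ⟨e + 2, by omega⟩
    simp only [Fin.castSucc_mk] at a1 a2
    omega
  · rintro ⟨g1, g2, g3, g4, g5, g6⟩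
    refine ⟨fun j => ?_, fun j => ?_, by omega, by omega⟩
    · have t1 := tail_le ν j
      have := j.2
      by_cases hj : (j : ℕ) ≤ e
      · rw [hfirst _ (by simpa using hj)]
        omega
      · have : j = ⟨e + 1, f1⟩ ∨ j = ⟨e + 2, f2⟩ := by
          simp only [Fin.ext_iff]; omega
        rcases this with rfl | rfl
        · simp only [Fin.castSucc_mk]; omega
        · simp only [Fin.castSucc_mk]; omega
    · have t1 := tail_le ν j
      have := j.2
      by_cases hj : (j : ℕ) < e
      · have := quad_tail ℓ j _ _ _ _ (by simpa using hj) l01 l12 l23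
        omega
      · have : j = ⟨e, f0⟩ ∨ j = ⟨e + 1, f1⟩ ∨ j = ⟨e + 2, f2⟩ := by
          simp only [Fin.ext_iff]; omega
        rcases this with rfl | rfl | rfl <;> omega

/-- Case `k = d - 1`. -/
lemma case_two (e N : ℕ) (ℓ : Fin (e + 3 + 1) → ℕ)
    (hfirst : ∀ t : Fin (e + 3 + 1), (t : ℕ) ≤ e → ℓ t = N) (a b c : ℕ)
    (ha : ℓ ⟨e + 1, by omega⟩ = a) (hb : ℓ ⟨e + 2, by omega⟩ = b) (hc : ℓ ⟨e + 3, by omega⟩ = c)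
    (haN : a < N)
    (hab : N ≤ a + b) (hac : N ≤ a + c) (hbc : N ≤ b + c) :
    (Hd (e + 3) N (Function.update ℓ ⟨e + 1, by omega⟩ (a + 1)) \ Hd (e + 3) N ℓ).card =
      (Slice (e + 3) N a ⟨e + 1, by omega⟩).card := by
  have f0 : e < e + 3 := by omega
  have f1 : e + 1 < e + 3 := by omega
  have f2 : e + 2 < e + 3 := by omega
  have n01 : (⟨e, f0⟩ : Fin (e + 3)) ≠ ⟨e + 1, f1⟩ := by simp [Fin.ext_iff]
  have n20 : (⟨e + 2, f2⟩ : Fin (e + 3)) ≠ ⟨e, f0⟩ := by simp [Fin.ext_iff]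
  have n21 : (⟨e + 2, f2⟩ : Fin (e + 3)) ≠ ⟨e + 1, f1⟩ := by simp [Fin.ext_iff]
  let upd : (Fin (e + 3) → ℕ) → ℕ → ℕ → (Fin (e + 3) → ℕ) := fun ν z x =>
    Function.update (Function.update ν ⟨e, f0⟩ z) ⟨e + 1, f1⟩ x
  have upd0 : ∀ ν z x, upd ν z x ⟨e, f0⟩ = z := by
    intro ν z x
    simp only [upd]
    rw [Function.update_of_ne n01, Function.update_self]
  have upd1 : ∀ ν z x, upd ν z x ⟨e + 1, f1⟩ = x := by
    intro ν z x
    simp only [upd]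
    rw [Function.update_self]
  have upd2 : ∀ ν z x, upd ν z x ⟨e + 2, f2⟩ = ν ⟨e + 2, f2⟩ := by
    intro ν z x
    simp only [upd]
    rw [Function.update_of_ne n21, Function.update_of_ne n20]
  have updh : ∀ ν z x, headSum e (upd ν z x) = headSum e ν := by
    intro ν z x
    simp only [upd]
    rw [headSum_update _ _ _ (by simp), headSum_update _ _ _ (by simp)]
  have updupd : ∀ ν z x z' x', z' = ν ⟨e, f0⟩ → x' = ν ⟨e + 1, f1⟩ →
      upd (upd ν z x) z' x' = ν := by
    rintro ν z x z' x' rfl rfl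
    funext i
    by_cases h1 : i = ⟨e + 1, f1⟩
    · subst h1; rw [upd1]
    · by_cases h0 : i = ⟨e, f0⟩
      · subst h0; rw [upd0]
      · simp only [upd]
        rw [Function.update_of_ne h1, Function.update_of_ne h0, Function.update_of_ne h1,
          Function.update_of_ne h0]
  have memS : ∀ ν, ν ∈ Slice (e + 3) N a ⟨e + 1, by omega⟩ ↔ ν ⟨e + 1, f1⟩ = a + 1 ∧
      headSum e ν + (ν ⟨e, f0⟩ + ν ⟨e + 1, f1⟩ + ν ⟨e + 2, f2⟩) ≤ N := by
    intro ν
    rw [mem_Slice_iff, sum_eq_head]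
  have memH : ∀ ν, ν ∈ (Hd (e + 3) N (Function.update ℓ ⟨e + 1, by omega⟩ (a + 1)) \
      Hd (e + 3) N ℓ) ↔ (ν ⟨e + 2, f2⟩ ≤ b ∧ ν ⟨e + 2, f2⟩ ≤ c ∧
        ν ⟨e + 1, f1⟩ + 2 * ν ⟨e + 2, f2⟩ ≤ b + c ∧
        headSum e ν + (ν ⟨e, f0⟩ + ν ⟨e + 1, f1⟩ + ν ⟨e + 2, f2⟩) ≤ N ∧
        ((ν ⟨e + 1, f1⟩ = a + 1 ∧ 
          ν ⟨e, f0⟩ + 2 * (ν ⟨e + 1, f1⟩ + ν ⟨e + 2, f2⟩) ≤ a + b + c + 1) ∨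
          (ν ⟨e + 1, f1⟩ ≤ a ∧
          ν ⟨e, f0⟩ + 2 * (ν ⟨e + 1, f1⟩ + ν ⟨e + 2, f2⟩) = a + b + c + 1))) := by
    intro ν
    rw [Finset.mem_sdiff, mem_two e N ℓ hfirst a b c ha hb hc hab ν _ _ _ rfl rfl rfl,
      mem_two e N _ ?_ (a + 1) b c ?_ ?_ ?_ (by omega) ν _ _ _ rfl rfl rfl]
    · omega
    · intro t ht
      rw [Function.update_of_ne, hfirst t ht]
      simp only [ne_eq, Fin.ext_iff]
      omega
    · rw [Function.update_self]
    · rw [Function.update_of_ne (by simp [Fin.ext_iff]), hb]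
    · rw [Function.update_of_ne (by simp [Fin.ext_iff]), hc]
  refine Finset.card_nbij'
    (fun ν => if ν ⟨e + 1, f1⟩ = a + 1 then ν else
      upd ν (b + c - ν ⟨e + 1, f1⟩ - 2 * ν ⟨e + 2, f2⟩) (a + 1))
    (fun ν => if ν ⟨e, f0⟩ + 2 * ν ⟨e + 2, f2⟩ + a + 1 ≤ b + c then ν else
      upd ν (a + 1 + 2 * ν ⟨e, f0⟩ + 2 * ν ⟨e + 2, f2⟩ - b - c)
        (b + c - ν ⟨e, f0⟩ - 2 * ν ⟨e + 2, f2⟩)) ?_ ?_ ?_ ?_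
  · intro ν hν
    have hν := (memH ν).1 hν
    rw [Finset.mem_coe]
    dsimp only
    split_ifs with h
    · rw [memS]; omega
    · rw [memS, upd0, upd1, upd2, updh]; omega
  · intro ν hν
    have hν := (memS ν).1 hν
    rw [Finset.mem_coe]
    dsimp only
    split_ifs with h
    · rw [memH]; omega
    · rw [memH, upd0, upd1, upd2, updh]; omega
  · intro ν hν
    have hν := (memH ν).1 hν
    dsimp only
    by_cases h : ν ⟨e + 1, f1⟩ = a + 1
    · rw [if_pos h, if_pos (by omega)]
    · rw [if_neg h, upd0, upd2, if_neg (by omega), updupd]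
      · omega
      · omega
  · intro ν hν
    have hν := (memS ν).1 hν
    dsimp only
    by_cases h : ν ⟨e, f0⟩ + 2 * ν ⟨e + 2, f2⟩ + a + 1 ≤ b + c
    · rw [if_pos h, if_pos (by omega)]
    · rw [if_neg h, upd1, upd2, if_neg (by omega), updupd]
      · omega
      · omega

/-- Lemma 5.2: for `k ∈ {1,…,d-1}` (1-indexed) and parameters
`(N,…,N,ℓ_k,ℓ_{k+1},…,ℓ_{d+1})` whose first `k-1` entries equal `N`,
`|H^d(…,ℓ_k+1,…)| - |H^d(…,ℓ_k,…)| = C(N-ℓ_k+d-2, d-1)`. -/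
theorem stmt18 (d N k : ℕ) (hd : 3 ≤ d) (hN : 1 ≤ N)
    (hk1 : 1 ≤ k) (hkd : k ≤ d - 1) (ℓ : Fin (d + 1) → ℕ)
    (hfirst : ∀ t : Fin (d + 1), (t : ℕ) + 1 < k → ℓ t = N)
    (hklt : ℓ ⟨k - 1, by omega⟩ < N)
    (hle : ∀ t : Fin (d + 1), k - 1 ≤ (t : ℕ) → ℓ t ≤ N)
    (hpair : ∀ s t : Fin (d + 1), k - 1 ≤ (s : ℕ) → s < t → N ≤ ℓ s + ℓ t) :
    ((Hd d N (Function.update ℓ ⟨k - 1, by omega⟩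
        (ℓ ⟨k - 1, by omega⟩ + 1))).card : ℤ) - ((Hd d N ℓ).card : ℤ) =
      ((N - ℓ ⟨k - 1, by omega⟩ + d - 2).choose (d - 1) : ℤ) := by
  have key : (Hd d N (Function.update ℓ ⟨k - 1, by omega⟩ (ℓ ⟨k - 1, by omega⟩ + 1)) \
      Hd d N ℓ).card = (N - ℓ ⟨k - 1, by omega⟩ + d - 2).choose (d - 1) := by
    rw [← card_Slice d N (ℓ ⟨k - 1, by omega⟩) ⟨k - 1, by omega⟩ hklt]
    by_cases hk : k + 2 ≤ d
    · rw [case_one d N (k - 1) (by omega) ℓ (fun t ht => hfirst t (by omega)) hklt hpair]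
    · obtain ⟨e, rfl⟩ : ∃ e, d = e + 3 := ⟨d - 3, by omega⟩
      obtain rfl : k = e + 2 := by omega
      exact case_two e N ℓ (fun t ht => hfirst t (by omega)) _ _ _ rfl rfl rfl hklt
        (hpair _ _ (by simp) (by simp [Fin.lt_def]))
        (hpair _ _ (by simp) (by simp [Fin.lt_def]))
        (hpair _ _ (by simp) (by simp [Fin.lt_def]))
  have hs := Finset.card_sdiff_add_card_eq_card (Hd_mono (N := N) ℓ ⟨k - 1, by omega⟩)
  rw [← key, ← hs]
  push_cast
  ring
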